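/- arXiv:math/0212262 — 2 statements merged into one kernel-verified Lean document; each statement's English description precedes it below -/
import Mathlib

section
/- For every integer n ≥ 2, V(n, n+1) = (1/n!)·√((n+1)/2^n); that is, the supremum of the volumes of convex hulls of (n+1)-point sets of diameter at most 1 in ℝⁿ equals (1/n!)·√((n+1)/2^n). -/
open MeasureTheory Metric Set

/-- `polyVol n k` is the supremum, over all sets `S` of `k` points in Euclidean `n`-space
whose diameter is at most 1, of the `n`-dimensional Lebesgue measure of the convex hull
of `S`. -/
noncomputable def polyVol (n k : ℕ) : ℝ :=
  sSup {v : ℝ | ∃ S : Finset (EuclideanSpace ℝ (Fin n)),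
    S.card = k ∧ Metric.diam (S : Set (EuclideanSpace ℝ (Fin n))) ≤ 1 ∧
    v = (volume (convexHull ℝ (S : Set (EuclideanSpace ℝ (Fin n))))).toReal}

/-- The corner simplex of size `r`. -/
def cornerSimplex (n : ℕ) (r : ℝ) : Set (Fin n → ℝ) :=
  {x | (∀ i, 0 ≤ x i) ∧ ∑ i, x i ≤ r}

lemma isClosed_cornerSimplex (n : ℕ) (r : ℝ) : IsClosed (cornerSimplex n r) := by
  have h1 : IsClosed {x : Fin n → ℝ | ∀ i, 0 ≤ x i} := by
    simp only [ofPred_forall]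
    exact isClosed_iInter fun i => isClosed_le continuous_const (continuous_apply i)
  have h2 : IsClosed {x : Fin n → ℝ | ∑ i, x i ≤ r} :=
    isClosed_le (by fun_prop) continuous_const
  exact h1.inter h2

lemma volume_cornerSimplex (n : ℕ) : ∀ r : ℝ, 0 ≤ r →
    volume (cornerSimplex n r) = ENNReal.ofReal (r ^ n / n.factorial) := by
  induction n with
  | zero =>
    intro r hr
    have : cornerSimplex 0 r = univ := by
      ext x; simp [cornerSimplex, hr]
    rw [this]
    simp [volume_pi]
  | succ n ih =>
    intro r hr
    have hmp := volume_preserving_piFinSuccAbove (fun _ : Fin (n + 1) => ℝ) 0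
    let e := MeasurableEquiv.piFinSuccAbove (fun _ : Fin (n + 1) => ℝ) 0
    let s : Set (ℝ × (Fin n → ℝ)) := {q | 0 ≤ q.1 ∧ q.2 ∈ cornerSimplex n (r - q.1)}
    have hs : MeasurableSet s := by
      have : IsClosed s := by
        have h0 : IsClosed {q : ℝ × (Fin n → ℝ) | 0 ≤ q.1} :=
          isClosed_le continuous_const continuous_fst
        have h1 : IsClosed {q : ℝ × (Fin n → ℝ) | ∀ i, 0 ≤ q.2 i} := by
          simp only [ofPred_forall]
          exact isClosed_iInter fun i => isClosed_le continuous_const (by fun_prop)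
        have h2 : IsClosed {q : ℝ × (Fin n → ℝ) | ∑ i, q.2 i ≤ r - q.1} :=
          isClosed_le (by fun_prop) (by fun_prop)
        exact h0.inter (h1.inter h2)
      exact this.measurableSet
    have hpre : cornerSimplex (n + 1) r = e ⁻¹' s := by
      ext x
      simp only [cornerSimplex, mem_ofPred_eq, mem_preimage, s, e,
        MeasurableEquiv.piFinSuccAbove_apply, Fin.insertNthEquiv_zero, Fin.consEquiv_symm_apply,
        Fin.forall_fin_succ, Fin.sum_univ_succ, Fin.tail]
      constructor
      · rintro ⟨⟨h0, h1⟩, h2⟩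
        exact ⟨h0, h1, by linarith⟩
      · rintro ⟨h0, h1, h2⟩
        exact ⟨⟨h0, h1⟩, by linarith⟩
    rw [hpre, hmp.measure_preimage hs.nullMeasurableSet, Measure.volume_eq_prod,
      Measure.prod_apply hs]
    have hsl : ∀ t : ℝ, volume (Prod.mk t ⁻¹' s) =
        (Icc 0 r).indicator (fun t => ENNReal.ofReal ((r - t) ^ n / n.factorial)) t := by
      intro t
      by_cases ht : t ∈ Icc 0 r
      · rw [indicator_of_mem ht, ← ih (r - t) (by linarith [ht.2])]
        congr 1
        ext y
        simp [s, ht.1]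
      · rw [indicator_of_notMem ht]
        convert measure_empty (μ := (volume : Measure (Fin n → ℝ)))
        ext y
        simp only [s, mem_preimage, mem_ofPred_eq, cornerSimplex, mem_empty_iff_false, iff_false]
        rintro ⟨h0, h1, h2⟩
        have := Finset.sum_nonneg (fun i (_ : i ∈ Finset.univ) => h1 i)
        exact ht ⟨h0, by linarith⟩
    simp_rw [hsl]
    rw [lintegral_indicator measurableSet_Icc, ← ofReal_integral_eq_lintegral_ofReal]
    · congr 1
      rw [integral_Icc_eq_integral_Ioc, ← intervalIntegral.integral_of_le hr,
        intervalIntegral.integral_div,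
        intervalIntegral.integral_comp_sub_left (fun x => x ^ n) r]
      simp only [sub_self, sub_zero, integral_pow, Nat.factorial_succ]
      push_cast
      have : (n.factorial : ℝ) ≠ 0 := by positivity
      field_simp
      simp
    · exact (Continuous.continuousOn (by fun_prop)).integrableOn_Icc
    · rw [Filter.EventuallyLE, ae_restrict_iff' measurableSet_Icc]
      refine Filter.Eventually.of_forall fun t ht => ?_
      have := ht.2
      have h : 0 ≤ r - t := by linarith
      show (0 : ℝ) ≤ _
      positivity

/-- Vertices of the corner simplex. -/
noncomputable def cornerVert (n : ℕ) : Fin (n + 1) → (Fin n → ℝ) :=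
  Fin.cons 0 (fun i => Pi.single i 1)

lemma convexHull_cornerVert (n : ℕ) :
    convexHull ℝ (range (cornerVert n)) = cornerSimplex n 1 := by
  apply Subset.antisymm
  · apply convexHull_min
    · rintro _ ⟨i, rfl⟩
      refine Fin.cases ?_ (fun j => ?_) i
      · simp [cornerVert, cornerSimplex]
      · refine ⟨fun k => ?_, ?_⟩
        · simp only [cornerVert, Fin.cons_succ, Pi.single_apply]
          split_ifs <;> norm_num
        · simp [cornerVert]
    · rintro x ⟨hx, hx'⟩ y ⟨hy, hy'⟩ a b ha hb hab
      refine ⟨fun i => ?_, ?_⟩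
      · have := mul_nonneg ha (hx i)
        have := mul_nonneg hb (hy i)
        simp only [Pi.add_apply, Pi.smul_apply, smul_eq_mul]
        linarith
      · simp only [Pi.add_apply, Pi.smul_apply, smul_eq_mul, Finset.sum_add_distrib,
          ← Finset.mul_sum]
        nlinarith
  · rintro x ⟨hx, hx'⟩
    have := (convex_convexHull ℝ (range (cornerVert n))).sum_mem (t := Finset.univ)
      (w := (Fin.cons (1 - ∑ i, x i) x : Fin (n + 1) → ℝ)) (z := cornerVert n)
      (fun i _ => by
        refine Fin.cases ?_ (fun j => ?_) i
        · simpa using hx'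
        · simpa using hx j)
      (by simp [Fin.sum_univ_succ])
      (fun i _ => subset_convexHull ℝ _ (mem_range_self i))
    convert this
    rw [Fin.sum_univ_succ]
    simp only [cornerVert, Fin.cons_zero, Fin.cons_succ, smul_zero, zero_add]
    ext k
    simp [Finset.sum_apply, Pi.single_apply]

/-- Edge matrix of a simplex. -/
def edgeMat {n : ℕ} (p : Fin (n + 1) → EuclideanSpace ℝ (Fin n)) : Matrix (Fin n) (Fin n) ℝ :=
  Matrix.of fun i j => p j.succ i - p 0 i

lemma volume_simplex {n : ℕ} (p : Fin (n + 1) → EuclideanSpace ℝ (Fin n)) :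
    volume (convexHull ℝ (range p)) =
      ENNReal.ofReal (|(edgeMat p).det| / n.factorial) := by
  let L := (EuclideanSpace.equiv (Fin n) ℝ).toLinearEquiv
  have h1 : convexHull ℝ (range p) =
      (WithLp.ofLp : EuclideanSpace ℝ (Fin n) → _) ⁻¹' 
        ((fun x => -(p 0).ofLp + x) ⁻¹' (Matrix.toLin' (edgeMat p) '' cornerSimplex n 1)) := by
    rw [← convexHull_cornerVert, LinearMap.image_convexHull]
    let A : EuclideanSpace ℝ (Fin n) →ᵃ[ℝ] (Fin n → ℝ) :=
      (AffineEquiv.constVAdd ℝ (Fin n → ℝ) (-(p 0).ofLp)).toAffineMap.comp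
        L.toLinearMap.toAffineMap
    have hA : ∀ x, A x = -(p 0).ofLp + x.ofLp := fun x => rfl
    have hinj : Function.Injective A := by
      intro x y hxy
      rw [hA, hA] at hxy
      exact WithLp.ofLp_injective 2 (add_left_cancel hxy)
    have h2 := A.image_convexHull (range p)
    have h3 : A '' range p = (Matrix.toLin' (edgeMat p)) '' range (cornerVert n) := by
      rw [← range_comp, ← range_comp]
      congr 1
      ext i k
      refine Fin.cases ?_ (fun j => ?_) i
      · simp [hA, cornerVert]
      · simp [hA, cornerVert, edgeMat]
        ring
    rw [← h3, ← h2]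
    exact (preimage_image_eq _ hinj).symm
  have hcl : MeasurableSet (Matrix.toLin' (edgeMat p) '' cornerSimplex n 1) := by
    have hc : IsCompact (cornerSimplex n 1) := by
      rw [← convexHull_cornerVert]
      exact (finite_range _).isCompact_convexHull ℝ
    exact (hc.image (LinearMap.continuous_of_finiteDimensional _)).measurableSet
  rw [h1, (PiLp.volume_preserving_ofLp (Fin n)).measure_preimage
    ((measurable_const_add _ hcl).nullMeasurableSet), measure_preimage_add,
    Measure.addHaar_image_linearMap, volume_cornerSimplex n 1 zero_le_one, LinearMap.det_toLin',
    ← ENNReal.ofReal_mul (abs_nonneg _)]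
  congr 1
  simp [div_eq_mul_inv]

lemma det_one_add_const (n : ℕ) (c : ℝ) :
    (1 + Matrix.of fun _ _ => c : Matrix (Fin n) (Fin n) ℝ).det = 1 + n * c := by
  have := Matrix.det_one_add_replicateCol_mul_replicateRow (ι := Unit)
    (fun _ : Fin n => c) (fun _ : Fin n => (1 : ℝ))
  rw [show (1 + n * c : ℝ) = 1 + (fun _ : Fin n => (1 : ℝ)) ⬝ᵥ (fun _ : Fin n => c) by
    simp [dotProduct], ← this]
  congr 2
  ext i j
  simp [Matrix.mul_apply]

lemma det_le_of_trace {n : ℕ} {M : Matrix (Fin n) (Fin n) ℝ} (hM : M.PosSemidef)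
    (ht : M.trace ≤ n / 2) : 2 ^ n * M.det ≤ 1 := by
  rw [hM.1.det_eq_prod_eigenvalues]
  have htr := hM.1.trace_eq_sum_eigenvalues
  simp only [RCLike.ofReal_real_eq_id, id] at htr ⊢
  have h1 : (2 : ℝ) ^ n * ∏ i, hM.1.eigenvalues i = ∏ i, (2 * hM.1.eigenvalues i) := by
    simp [Finset.prod_mul_distrib]
  rw [h1]
  calc ∏ i, (2 * hM.1.eigenvalues i) ≤ ∏ i, Real.exp (2 * hM.1.eigenvalues i - 1) := by
        apply Finset.prod_le_prod
        · intro i _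
          have := hM.eigenvalues_nonneg i
          positivity
        · intro i _
          have := Real.add_one_le_exp (2 * hM.1.eigenvalues i - 1)
          linarith
    _ = Real.exp (∑ i, (2 * hM.1.eigenvalues i - 1)) := (Real.exp_sum _ _).symm
    _ ≤ 1 := by
        rw [Real.exp_le_one_iff, Finset.sum_sub_distrib, ← Finset.mul_sum, ← htr]
        simp
        linarith

lemma det_edge_le {n : ℕ} (p : Fin (n + 1) → EuclideanSpace ℝ (Fin n))
    (hp : ∀ i j, dist (p i) (p j) ≤ 1) :
    2 ^ n * (edgeMat p).det ^ 2 ≤ n + 1 := by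
  set A := edgeMat p with hA
  have hn : (0 : ℝ) < n + 1 := by positivity
  let C : Matrix (Fin n) (Fin n) ℝ := 1 + Matrix.of fun _ _ => -1 / ((n : ℝ) + 1)
  have hdC : C.det = 1 / (n + 1) := by
    rw [det_one_add_const]; field_simp; ring
  have hC : C.PosSemidef := by
    apply Matrix.PosSemidef.of_dotProduct_mulVec_nonneg
    · ext i j
      simp [C, Matrix.one_apply, eq_comm]
    · intro x
      have h := sq_sum_le_card_mul_sum_sq (s := Finset.univ) (f := x)
      have h0 : 0 ≤ ∑ i, x i ^ 2 := Finset.sum_nonneg fun i _ => sq_nonneg _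
      simp only [Finset.card_univ, Fintype.card_fin] at h
      have : star x ⬝ᵥ C.mulVec x = ∑ i, x i ^ 2 - (∑ i, x i) ^ 2 / (n + 1) := by
        rw [Matrix.add_mulVec, Matrix.one_mulVec, dotProduct_add]
        simp only [dotProduct, Matrix.mulVec, star_trivial, Matrix.of_apply, ← Finset.mul_sum,
          ← Finset.sum_mul]
        simp only [← sq]
        ring
      rw [this, sub_nonneg, div_le_iff₀ hn]
      nlinarith
  have hM := hC.mul_mul_conjTranspose_same A
  have hd2 : ∀ i j, ∑ k, (p i k - p j k) ^ 2 ≤ 1 := by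
    intro i j
    have h := hp i j
    rw [EuclideanSpace.dist_eq, Real.sqrt_le_iff, one_pow] at h
    replace h := h.2
    simpa [Real.dist_eq, sq_abs] using h
  have htr : (A * C * A.conjTranspose).trace =
      ∑ k, (∑ j, A k j ^ 2 - (∑ j, A k j) ^ 2 / (n + 1)) := by
    rw [Matrix.trace]
    refine Finset.sum_congr rfl fun k _ => ?_
    rw [Matrix.diag_apply, Matrix.mul_add, Matrix.add_mul, Matrix.add_apply]
    simp only [Matrix.mul_one, Matrix.mul_apply, Matrix.conjTranspose_apply, star_trivial,
      Matrix.of_apply, ← Finset.sum_mul, ← Finset.mul_sum]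
    simp only [← sq]
    ring
  have hkey : ∀ k, (n + 1) * (∑ j, A k j ^ 2 - (∑ j, A k j) ^ 2 / (n + 1)) =
      ∑ j, A k j ^ 2 + (1 / 2) * ∑ i, ∑ j, (A k i - A k j) ^ 2 := by
    intro k
    have : ∑ i, ∑ j, (A k i - A k j) ^ 2 = 2 * n * ∑ j, A k j ^ 2 - 2 * (∑ j, A k j) ^ 2 := by
      simp only [sub_sq, Finset.sum_add_distrib, Finset.sum_sub_distrib, ← Finset.mul_sum,
        ← Finset.sum_mul, Finset.sum_const, Finset.card_univ, Fintype.card_fin, nsmul_eq_mul]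
      ring
    rw [this]
    field_simp
    ring
  have htr2 : (A * C * A.conjTranspose).trace ≤ n / 2 := by
    have h1 : (n + 1) * (A * C * A.conjTranspose).trace =
        ∑ j, ∑ k, A k j ^ 2 + (1 / 2) * ∑ i, ∑ j, ∑ k, (A k i - A k j) ^ 2 := by
      rw [htr, Finset.mul_sum, Finset.sum_congr rfl fun k _ => hkey k, Finset.sum_add_distrib,
        ← Finset.mul_sum, Finset.sum_comm]
      congr 2
      rw [Finset.sum_comm]
      refine Finset.sum_congr rfl fun i _ => ?_
      rw [Finset.sum_comm]
    have h2 : ∑ j, ∑ k, A k j ^ 2 ≤ n := by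
      calc ∑ j, ∑ k, A k j ^ 2 ≤ ∑ j : Fin n, (1 : ℝ) :=
            Finset.sum_le_sum fun j _ => hd2 j.succ 0
        _ = n := by simp
    have h3 : ∑ i, ∑ j, ∑ k, (A k i - A k j) ^ 2 ≤ n * (n - 1) := by
      calc ∑ i, ∑ j, ∑ k, (A k i - A k j) ^ 2
          ≤ ∑ i : Fin n, ∑ j : Fin n, (1 - if i = j then (1 : ℝ) else 0) := by
            refine Finset.sum_le_sum fun i _ => Finset.sum_le_sum fun j _ => ?_
            split_ifs with hij
            · simp [hij]
            · have := hd2 i.succ j.succ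
              simpa [hA, edgeMat] using this
        _ = n * (n - 1) := by
          simp [Finset.sum_sub_distrib]
          ring
    nlinarith
  have := det_le_of_trace hM htr2
  rw [Matrix.det_mul, Matrix.det_mul, Matrix.conjTranspose_eq_transpose_of_trivial,
    Matrix.det_transpose, hdC] at this
  have h5 : 2 ^ n * A.det ^ 2 = (n + 1) * (2 ^ n * (A.det * (1 / (n + 1)) * A.det)) := by
    field_simp
  rw [h5]
  nlinarith

/-- Vertices of the regular simplex with edge length one. -/
noncomputable def regVert (n : ℕ) : Fin (n + 1) → EuclideanSpace ℝ (Fin n) :=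
  Fin.cons 0 (fun j => WithLp.toLp 2 fun i =>
    (Real.sqrt 2)⁻¹ * ((if i = j then 1 else 0) + (Real.sqrt (n + 1) - 1) / n))

lemma regVert_dist (n : ℕ) (hn : 2 ≤ n) (i j : Fin (n + 1)) (hij : i ≠ j) :
    dist (regVert n i) (regVert n j) = 1 := by
  have hn0 : (n : ℝ) ≠ 0 := by positivity
  have hs : Real.sqrt (n + 1) ^ 2 = n + 1 := Real.sq_sqrt (by positivity)
  have h2 : (Real.sqrt 2)⁻¹ ^ 2 = 1 / 2 := by
    rw [inv_pow, Real.sq_sqrt (by norm_num)]; norm_num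
  have key : ∀ j : Fin n, dist (regVert n j.succ) (regVert n 0) = 1 := by
    intro j
    rw [EuclideanSpace.dist_eq, Real.sqrt_eq_one]
    simp only [regVert, Fin.cons_succ, Fin.cons_zero, Real.dist_eq, sq_abs, PiLp.zero_apply,
      sub_zero, mul_pow, h2, ← Finset.mul_sum, add_sq, ite_pow, Finset.sum_add_distrib]
    simp [← Finset.sum_mul, ← Finset.mul_sum]
    field_simp
    nlinarith
  revert hij
  refine Fin.cases ?_ (fun i => ?_) i <;> refine Fin.cases ?_ (fun j => ?_) j
  · simp
  · intro _
    rw [dist_comm]; exact key j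
  · intro _
    exact key i
  · intro hij
    have hij' : i ≠ j := fun h => hij (by rw [h])
    rw [EuclideanSpace.dist_eq, Real.sqrt_eq_one]
    simp only [regVert, Fin.cons_succ, Real.dist_eq, sq_abs, ← mul_sub, add_sub_add_right_eq_sub,
      mul_pow, h2, ← Finset.mul_sum]
    have : ∀ x : Fin n, ((if x = i then (1 : ℝ) else 0) - if x = j then 1 else 0) ^ 2 =
        (if x = i then 1 else 0) + (if x = j then 1 else 0) := by
      intro x
      by_cases h1 : x = i
      · have : x ≠ j := fun h => hij' (h1.symm.trans h)
        simp [h1, hij']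
      · by_cases h2 : x = j <;> simp [h1, h2, hij'.symm]
    simp only [this, Finset.sum_add_distrib]
    simp
    norm_num

lemma regVert_det (n : ℕ) (hn : 2 ≤ n) :
    |(edgeMat (regVert n)).det| = Real.sqrt (((n : ℝ) + 1) / 2 ^ n) := by
  have hn0 : (n : ℝ) ≠ 0 := by positivity
  have h : edgeMat (regVert n) = (Real.sqrt 2)⁻¹ •
      (1 + Matrix.of fun _ _ => (Real.sqrt (n + 1) - 1) / n) := by
    ext i j
    simp [edgeMat, regVert, Matrix.one_apply]
  rw [h, Matrix.det_smul, det_one_add_const, mul_div_cancel₀ _ hn0, Fintype.card_fin,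
    abs_of_nonneg (by have := Real.sqrt_nonneg ((n : ℝ) + 1); simp only [add_sub_cancel]; positivity)]
  rw [Real.sqrt_div (by positivity), inv_pow]
  rw [show Real.sqrt ((2 : ℝ) ^ n) = Real.sqrt 2 ^ n by
    rw [Real.sqrt_eq_iff_mul_self_eq (by positivity) (by positivity), ← mul_pow,
      Real.mul_self_sqrt (by norm_num)]]
  field_simp
  ring

theorem stmt_0 (n : ℕ) (hn : 2 ≤ n) :
    polyVol n (n + 1) =
      (1 / (Nat.factorial n : ℝ)) * Real.sqrt (((n : ℝ) + 1) / 2 ^ n) := by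
  apply IsGreatest.csSup_eq
  constructor
  · have hinj : Function.Injective (regVert n) := by
      intro i j hij
      by_contra hne
      have := regVert_dist n hn i j hne
      rw [hij, dist_self] at this
      norm_num at this
    refine ⟨Finset.univ.map ⟨regVert n, hinj⟩, by simp, ?_, ?_⟩
    · apply Metric.diam_le_of_forall_dist_le zero_le_one
      intro x hx y hy
      simp only [Finset.coe_map, Function.Embedding.coeFn_mk, Finset.coe_univ, image_univ,
        mem_range] at hx hy
      obtain ⟨i, rfl⟩ := hx
      obtain ⟨j, rfl⟩ := hy
      by_cases hij : i = j
      · simp [hij]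
      · exact (regVert_dist n hn i j hij).le
    · simp only [Finset.coe_map, Function.Embedding.coeFn_mk, Finset.coe_univ, image_univ]
      rw [volume_simplex, ENNReal.toReal_ofReal (by positivity), regVert_det n hn]
      ring
  · rintro v ⟨S, hS, hd, rfl⟩
    let p : Fin (n + 1) → EuclideanSpace ℝ (Fin n) := fun i => ((S.equivFinOfCardEq hS).symm i).1
    have hr : (S : Set (EuclideanSpace ℝ (Fin n))) = range p := by
      ext x
      constructor
      · intro hx
        exact ⟨S.equivFinOfCardEq hS ⟨x, hx⟩, by simp [p]⟩
      · rintro ⟨i, rfl⟩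
        exact ((S.equivFinOfCardEq hS).symm i).2
    have hp : ∀ i j, dist (p i) (p j) ≤ 1 := fun i j =>
      (Metric.dist_le_diam_of_mem S.finite_toSet.isBounded
        ((S.equivFinOfCardEq hS).symm i).2 ((S.equivFinOfCardEq hS).symm j).2).trans hd
    rw [hr, volume_simplex, ENNReal.toReal_ofReal (by positivity), div_eq_inv_mul, one_div]
    gcongr
    apply Real.le_sqrt_of_sq_le
    rw [sq_abs, le_div_iff₀ (by positivity)]
    have := det_edge_le p hp
    linarith
end

section
/- For every integer n ≥ 2, there exists a set of n+1 points in ℝⁿ of diameter exactly 1 (namely the vertices of a regular n-simplex of edge length 1) whose convex hull has n-dimensional Lebesgue measure equal to (1/n!)·√((n+1)/2^n), so the supremum V(n, n+1) is attained. -/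
open MeasureTheory Metric Set

def crn (n : ℕ) (r : ℝ) : Set (Fin n → ℝ) := {x | (∀ i, 0 ≤ x i) ∧ ∑ i, x i ≤ r}

lemma crn_meas (n : ℕ) (r : ℝ) : MeasurableSet (crn n r) := by
  apply IsClosed.measurableSet
  have : crn n r = (⋂ i, {x : Fin n → ℝ | 0 ≤ x i}) ∩ {x | ∑ i, x i ≤ r} := by
    ext x; simp [crn]
  rw [this]
  exact (isClosed_iInter fun i => isClosed_le continuous_const (continuous_apply i)).inter
    (isClosed_le (by fun_prop) continuous_const)

lemma crn_vol (n : ℕ) : ∀ r : ℝ, 0 ≤ r →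
    volume (crn n r) = ENNReal.ofReal (r ^ n / (Nat.factorial n : ℝ)) := by
  induction n with
  | zero =>
    intro r hr
    have : crn 0 r = univ := by ext x; simp [crn, hr]
    rw [this, volume_pi, Measure.pi_univ]; simp
  | succ n ih =>
    intro r hr
    have hmp := (volume_preserving_piFinSuccAbove (fun _ : Fin (n + 1) => ℝ) 0).symm
    rw [← hmp.measure_preimage (crn_meas _ _).nullMeasurableSet]
    rw [Measure.volume_eq_prod, Measure.prod_apply
      ((MeasurableEquiv.measurable _) (crn_meas _ _))]
    have hs : ∀ t : ℝ, volume (Prod.mk t ⁻¹' ((MeasurableEquiv.piFinSuccAbove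
        (fun _ : Fin (n + 1) => ℝ) 0).symm ⁻¹' crn (n + 1) r)) =
        (Icc (0 : ℝ) r).indicator
          (fun t => ENNReal.ofReal ((r - t) ^ n / (Nat.factorial n : ℝ))) t := by
      intro t
      by_cases ht : t ∈ Icc (0 : ℝ) r
      · rw [indicator_of_mem ht, ← ih (r - t) (by linarith [ht.2])]
        congr 1
        ext x
        simp only [crn, MeasurableEquiv.piFinSuccAbove, mem_preimage]
        simp [Fin.forall_fin_succ, Fin.sum_univ_succ, ht.1, le_sub_iff_add_le', Fin.insertNthEquiv]
      · rw [indicator_of_notMem ht]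
        convert measure_empty (μ := volume)
        ext x
        simp only [mem_Icc, not_and, not_le] at ht
        simp only [crn, MeasurableEquiv.piFinSuccAbove, mem_preimage]
        simp [Fin.forall_fin_succ, Fin.sum_univ_succ, Fin.insertNthEquiv]
        intro h0 h1
        have := ht h0
        have := Finset.sum_nonneg (s := Finset.univ) (fun i _ => h1 i)
        linarith
    simp_rw [hs]
    rw [lintegral_indicator measurableSet_Icc, ← ofReal_integral_eq_lintegral_ofReal]
    · congr 1
      rw [integral_Icc_eq_integral_Ioc, ← intervalIntegral.integral_of_le hr,
        intervalIntegral.integral_comp_sub_left (fun t => t ^ n / (Nat.factorial n : ℝ)) r]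
      simp [Nat.factorial_succ]
      field_simp
    · exact (Continuous.integrableOn_Icc (by fun_prop))
    · refine (ae_restrict_mem measurableSet_Icc).mono fun t ht => ?_
      have : 0 ≤ r - t := by linarith [ht.2]
      positivity

lemma hull_crn (n : ℕ) (x : Fin (n + 1) → EuclideanSpace ℝ (Fin n)) :
    convexHull ℝ (range x) =
      (fun w : Fin n → ℝ => x 0 + ∑ i, w i • (x i.succ - x 0)) '' crn n 1 := by
  apply Subset.antisymm
  · apply convexHull_min
    · rintro _ ⟨i, rfl⟩
      refine Fin.cases ?_ (fun i => ?_) i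
      · exact ⟨0, by simp [crn], by simp⟩
      · refine ⟨Pi.single i 1, ⟨fun j => ?_, by simp⟩, by simp [Pi.single_apply]⟩
        by_cases h : j = i <;> simp [h]
    · rintro _ ⟨u, hu, rfl⟩ _ ⟨v, hv, rfl⟩ a b ha hb hab
      refine ⟨a • u + b • v, ⟨fun i => ?_, ?_⟩, ?_⟩
      · have := hu.1 i; have := hv.1 i
        simp only [Pi.add_apply, Pi.smul_apply, smul_eq_mul]; positivity
      · simp only [Pi.add_apply, Pi.smul_apply, smul_eq_mul, Finset.sum_add_distrib,
          ← Finset.mul_sum]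
        nlinarith [mul_le_mul_of_nonneg_left hu.2 ha, mul_le_mul_of_nonneg_left hv.2 hb]
      · simp only [Pi.add_apply, Pi.smul_apply, smul_eq_mul, add_smul, mul_smul,
          Finset.sum_add_distrib, ← Finset.smul_sum, smul_add]
        have : x 0 = a • x 0 + b • x 0 := by rw [← add_smul, hab, one_smul]
        nth_rewrite 1 [this]
        abel
  · rintro _ ⟨w, hw, rfl⟩
    have h := (convex_convexHull ℝ (range x)).sum_mem (t := Finset.univ)
      (w := (Fin.cons (1 - ∑ i, w i) w : Fin (n + 1) → ℝ)) (z := x) ?_ ?_ ?_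
    · convert h using 1
      simp [Fin.sum_univ_succ, smul_sub, sub_smul, Finset.sum_smul]
      abel
    · intro i _
      refine Fin.cases ?_ (fun i => ?_) i
      · simpa using hw.2
      · simpa using hw.1 i
    · simp [Fin.sum_univ_succ]
    · intro i _; exact subset_convexHull _ _ ⟨i, rfl⟩

/-- edge matrix -/
def edgeM {n : ℕ} (x : Fin (n + 1) → EuclideanSpace ℝ (Fin n)) : Matrix (Fin n) (Fin n) ℝ :=
  Matrix.of fun i j => x i.succ j - x 0 j

lemma vol_hull (n : ℕ) (x : Fin (n + 1) → EuclideanSpace ℝ (Fin n)) :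
    (volume (convexHull ℝ (range x))).toReal =
      (1 / (Nat.factorial n : ℝ)) * |(edgeM x).det| := by
  have h1 : convexHull ℝ (range x) = (@WithLp.ofLp 2 (Fin n → ℝ)) ⁻¹'
      ((fun v => (x 0).ofLp + v) '' (Matrix.toLin' (edgeM x).transpose '' crn n 1)) := by
    rw [hull_crn, image_image]
    have key : ∀ w : Fin n → ℝ, (x 0 + ∑ i, w i • (x i.succ - x 0)).ofLp =
        (x 0).ofLp + Matrix.toLin' (edgeM x).transpose w := by
      intro w
      ext j
      simp [Matrix.mulVec, dotProduct, edgeM, mul_comm]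
    ext y
    simp only [mem_image, mem_preimage, ← key]
    constructor
    · rintro ⟨w, hw, rfl⟩; exact ⟨w, hw, rfl⟩
    · rintro ⟨w, hw, h⟩; exact ⟨w, hw, WithLp.ofLp_injective 2 h⟩
  rw [h1, (PiLp.volume_preserving_ofLp (Fin n)).measure_preimage_emb
    (MeasurableEquiv.toLp 2 (Fin n → ℝ)).symm.measurableEmbedding, image_add_left,
    measure_preimage_add, Measure.addHaar_image_linearMap, crn_vol n 1 zero_le_one]
  simp [ENNReal.toReal_mul]
  ring

def oneM (n : ℕ) : Matrix (Fin n) (Fin n) ℝ := Matrix.of fun _ _ => 1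

lemma oneM_mul (n : ℕ) : oneM n * oneM n = (n : ℝ) • oneM n := by
  ext i j; simp [oneM, Matrix.mul_apply]

noncomputable def regM (n : ℕ) : Matrix (Fin n) (Fin n) ℝ :=
  (Real.sqrt 2)⁻¹ • (1 + ((Real.sqrt (n + 1) - 1) / n) • oneM n)

noncomputable def gramM (n : ℕ) : Matrix (Fin n) (Fin n) ℝ :=
  (2 : ℝ)⁻¹ • (1 + oneM n)

lemma regM_sq (n : ℕ) (hn : 2 ≤ n) : regM n * regM n = gramM n := by
  have h2 : (Real.sqrt 2)⁻¹ * (Real.sqrt 2)⁻¹ = (2 : ℝ)⁻¹ := by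
    rw [← mul_inv, Real.mul_self_sqrt (by norm_num)]
  have hs : Real.sqrt (n + 1) * Real.sqrt (n + 1) = (n : ℝ) + 1 :=
    Real.mul_self_sqrt (by positivity)
  have hn0 : (n : ℝ) ≠ 0 := by positivity
  unfold regM gramM
  set a := (Real.sqrt (n + 1) - 1) / (n : ℝ) with ha
  have haa : a + a + a * a * n = 1 := by
    rw [ha]; field_simp; nlinarith
  rw [smul_mul_smul_comm, h2]
  congr 1
  have : (1 + a • oneM n) * (1 + a • oneM n) = 1 + (a + a + a * a * n) • oneM n := by
    simp only [mul_add, add_mul, one_mul, mul_one, smul_mul_smul_comm, oneM_mul]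
    module
  rw [this, haa, one_smul]

lemma regM_symm (n : ℕ) : (regM n).transpose = regM n := by
  ext i j; simp only [regM, oneM, Matrix.one_apply, Matrix.transpose_apply, Matrix.smul_apply,
    Matrix.add_apply, Matrix.of_apply, eq_comm]

lemma gramM_det (n : ℕ) : (gramM n).det = ((n : ℝ) + 1) / 2 ^ n := by
  have : oneM n = Matrix.replicateCol Unit (fun _ => (1 : ℝ)) *
      Matrix.replicateRow Unit (fun _ => (1 : ℝ)) := by
    ext i j; simp [oneM, Matrix.mul_apply]
  rw [gramM, Matrix.det_smul, this, Matrix.det_one_add_replicateCol_mul_replicateRow]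
  simp [dotProduct]
  field_simp
  ring

lemma regM_det_sq (n : ℕ) (hn : 2 ≤ n) : (regM n).det ^ 2 = ((n : ℝ) + 1) / 2 ^ n := by
  rw [← gramM_det, ← regM_sq n hn, Matrix.det_mul, sq]

lemma regM_abs_det (n : ℕ) (hn : 2 ≤ n) :
    |(regM n).det| = Real.sqrt (((n : ℝ) + 1) / 2 ^ n) := by
  rw [← regM_det_sq n hn, Real.sqrt_sq_eq_abs]

noncomputable def invM (n : ℕ) : Matrix (Fin n) (Fin n) ℝ :=
  (2 : ℝ) • (1 - ((n : ℝ) + 1)⁻¹ • oneM n)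

lemma gramM_inv (n : ℕ) : (gramM n)⁻¹ = invM n := by
  apply Matrix.inv_eq_right_inv
  have hn0 : (n : ℝ) + 1 ≠ 0 := by positivity
  unfold gramM invM
  rw [smul_mul_smul_comm]
  simp only [mul_sub, add_mul, one_mul, mul_one, mul_smul_comm, oneM_mul]
  have : (n + 1 : ℝ)⁻¹ • oneM n + (n + 1 : ℝ)⁻¹ • (n : ℝ) • oneM n = oneM n := by
    rw [smul_smul, ← add_smul]
    have : (n + 1 : ℝ)⁻¹ + (n + 1 : ℝ)⁻¹ * n = 1 := by field_simp; ring
    rw [this, one_smul]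
  rw [smul_add, this]
  simp

lemma det_sq_le_one (n : ℕ) (Q : Matrix (Fin n) (Fin n) ℝ)
    (h : (Q.transpose * Q).trace ≤ n) : Q.det ^ 2 ≤ 1 := by
  have hp : (Q.transpose * Q).PosSemidef := by
    have := Matrix.posSemidef_conjTranspose_mul_self Q
    rwa [Matrix.conjTranspose_eq_transpose_of_trivial] at this
  have hd : Q.det ^ 2 = (Q.transpose * Q).det := by
    rw [Matrix.det_mul, Matrix.det_transpose, sq]
  rw [hd, hp.1.det_eq_prod_eigenvalues]
  have ht := hp.1.trace_eq_sum_eigenvalues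
  simp only [RCLike.ofReal_real_eq_id, id] at ht ⊢
  calc ∏ i, hp.1.eigenvalues i ≤ ∏ i, Real.exp (hp.1.eigenvalues i - 1) := by
        apply Finset.prod_le_prod
        · intro i _; exact hp.eigenvalues_nonneg i
        · intro i _
          linarith [Real.add_one_le_exp (hp.1.eigenvalues i - 1)]
    _ = Real.exp (∑ i, (hp.1.eigenvalues i - 1)) := (Real.exp_sum _ _).symm
    _ ≤ 1 := by
        rw [Real.exp_le_one_iff, Finset.sum_sub_distrib, ← ht]
        simpa using h

lemma trace_inv (n : ℕ) (E : Matrix (Fin n) (Fin n) ℝ) :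
    (n + 1 : ℝ) * (E.transpose * invM n * E).trace =
      2 * ∑ i, ∑ j, E i j ^ 2 + ∑ i, ∑ k, ∑ j, (E i j - E k j) ^ 2 := by
  have hn0 : (n : ℝ) + 1 ≠ 0 := by positivity
  have h1 : (E.transpose * invM n * E).trace =
      ∑ j, (2 * ∑ i, E i j ^ 2 - 2 * (n + 1 : ℝ)⁻¹ * (∑ i, E i j) ^ 2) := by
    unfold Matrix.trace
    refine Finset.sum_congr rfl fun j _ => ?_
    unfold invM
    rw [Matrix.mul_assoc, Matrix.diag_apply, Matrix.mul_apply]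
    simp only [Matrix.smul_mul, sub_mul, one_mul, Matrix.smul_apply, Matrix.sub_apply,
      Matrix.transpose_apply, smul_eq_mul]
    have : ∀ i, (oneM n * E) i j = ∑ k, E k j := by
      intro i; simp [oneM, Matrix.mul_apply]
    simp only [this]
    generalize hs : ∑ k, E k j = s
    have : 2 * (n + 1 : ℝ)⁻¹ * s ^ 2 = ∑ k, 2 * (n + 1 : ℝ)⁻¹ * s * E k j := by
      rw [← Finset.mul_sum, hs]; ring
    rw [this, Finset.mul_sum, ← Finset.sum_sub_distrib]
    refine Finset.sum_congr rfl fun i _ => by ring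
  have h2 : ∀ j, ∑ i, ∑ k, (E i j - E k j) ^ 2 =
      2 * n * ∑ i, E i j ^ 2 - 2 * (∑ i, E i j) ^ 2 := by
    intro j
    simp only [sub_sq, Finset.sum_add_distrib, Finset.sum_sub_distrib, ← Finset.mul_sum,
      ← Finset.sum_mul]
    simp [← Finset.mul_sum]
    ring
  have h3 : ∑ i, ∑ k, ∑ j, (E i j - E k j) ^ 2 = ∑ j, ∑ i, ∑ k, (E i j - E k j) ^ 2 := by
    simp_rw [Finset.sum_comm (s := (Finset.univ : Finset (Fin n))) (t := Finset.univ)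
      (f := fun k j => (E _ j - E k j) ^ 2)]
    rw [Finset.sum_comm]
  rw [h1, h3, Finset.sum_comm (f := fun i j => E i j ^ 2), Finset.mul_sum, Finset.mul_sum,
    ← Finset.sum_add_distrib]
  refine Finset.sum_congr rfl fun j _ => ?_
  rw [h2]
  field_simp
  ring

lemma edge_det_le (n : ℕ) (hn : 2 ≤ n) (x : Fin (n + 1) → EuclideanSpace ℝ (Fin n))
    (hx : ∀ i j, dist (x i) (x j) ≤ 1) :
    |(edgeM x).det| ≤ Real.sqrt (((n : ℝ) + 1) / 2 ^ n) := by
  have hd : ∀ i j, ∑ k, (x i k - x j k) ^ 2 ≤ 1 := by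
    intro i j
    have h := hx i j
    rw [EuclideanSpace.dist_eq, Real.sqrt_le_one] at h
    simpa [Real.dist_eq] using h
  have htr : ((edgeM x).transpose * invM n * edgeM x).trace ≤ n := by
    have h := trace_inv n (edgeM x)
    have h1 : ∑ i, ∑ j, edgeM x i j ^ 2 ≤ n := by
      calc _ ≤ ∑ i : Fin n, (1 : ℝ) := Finset.sum_le_sum fun i _ => hd i.succ 0
        _ = n := by simp
    have h2 : ∑ i, ∑ k, ∑ j, (edgeM x i j - edgeM x k j) ^ 2 ≤ (n : ℝ) * n - n := by
      calc _ ≤ ∑ i : Fin n, ∑ k : Fin n, ((1 : ℝ) - if i = k then 1 else 0) := by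
            refine Finset.sum_le_sum fun i _ => Finset.sum_le_sum fun k _ => ?_
            by_cases hik : i = k
            · simp [hik]
            · simpa [hik, edgeM] using hd i.succ k.succ
        _ = _ := by simp [Finset.sum_sub_distrib]
    have hp : (0 : ℝ) < n + 1 := by positivity
    nlinarith
  have hR : (regM n).det ≠ 0 := by
    intro h0
    have := regM_det_sq n hn
    rw [h0] at this
    have : (0 : ℝ) < ((n : ℝ) + 1) / 2 ^ n := by positivity
    simp_all
  have hQ : ((regM n)⁻¹ * edgeM x).det ^ 2 ≤ 1 := by
    apply det_sq_le_one
    rw [Matrix.transpose_mul, Matrix.transpose_nonsing_inv, regM_symm]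
    have : (edgeM x).transpose * (regM n)⁻¹ * ((regM n)⁻¹ * edgeM x) =
        (edgeM x).transpose * invM n * edgeM x := by
      rw [← gramM_inv, ← regM_sq n hn, Matrix.mul_inv_rev]
      simp only [Matrix.mul_assoc]
    rwa [this]
  have hE : (edgeM x).det = (regM n).det * ((regM n)⁻¹ * edgeM x).det := by
    rw [← Matrix.det_mul, ← Matrix.mul_assoc, Matrix.mul_nonsing_inv _ (by simpa using hR),
      one_mul]
  rw [hE, abs_mul, regM_abs_det n hn]
  exact mul_le_of_le_one_right (Real.sqrt_nonneg _) ((sq_le_one_iff_abs_le_one _).1 hQ)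

noncomputable def regP (n : ℕ) : Fin (n + 1) → EuclideanSpace ℝ (Fin n) :=
  Fin.cons 0 fun i => WithLp.toLp 2 (regM n i)

lemma edge_regP (n : ℕ) : edgeM (regP n) = regM n := by
  ext i j; simp [edgeM, regP]

lemma regP_dist (n : ℕ) (hn : 2 ≤ n) (i j : Fin (n + 1)) (h : i ≠ j) :
    dist (regP n i) (regP n j) = 1 := by
  have hg : ∀ i j, ∑ k, regM n i k * regM n j k = gramM n i j := by
    intro i j
    rw [← regM_sq n hn, Matrix.mul_apply]
    refine Finset.sum_congr rfl fun k _ => ?_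
    conv_lhs => rw [← regM_symm n, Matrix.transpose_apply, Matrix.transpose_apply]
    conv_lhs => rw [← regM_symm n, Matrix.transpose_apply, regM_symm]
  have h1 : ∀ i, ∑ k, regM n i k ^ 2 = 1 := by
    intro i
    simp only [sq, hg]
    norm_num [gramM, oneM]
  have h2 : ∀ i j, i ≠ j → ∑ k, (regM n i k - regM n j k) ^ 2 = 1 := by
    intro i j hij
    simp only [sub_sq, Finset.sum_add_distrib, Finset.sum_sub_distrib, h1, mul_assoc,
      ← Finset.mul_sum, hg]
    norm_num [gramM, oneM, hij]
  rw [EuclideanSpace.dist_eq, Real.sqrt_eq_one]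
  simp only [Real.dist_eq, sq_abs]
  revert h
  refine Fin.cases ?_ (fun i => ?_) i <;> refine Fin.cases ?_ (fun j => ?_) j
  · simp
  · intro _; simpa [regP] using h1 j
  · intro _; simpa [regP] using h1 i
  · intro h; simpa [regP] using h2 i j (fun e => h (by rw [e]))

theorem stmt_1 (n : ℕ) (hn : 2 ≤ n) :
    ∃ S : Finset (EuclideanSpace ℝ (Fin n)),
      S.card = n + 1 ∧
      (∀ p ∈ S, ∀ q ∈ S, p ≠ q → dist p q = 1) ∧
      Metric.diam (S : Set (EuclideanSpace ℝ (Fin n))) = 1 ∧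
      (volume (convexHull ℝ (S : Set (EuclideanSpace ℝ (Fin n))))).toReal =
        (1 / (Nat.factorial n : ℝ)) * Real.sqrt (((n : ℝ) + 1) / 2 ^ n) ∧
      polyVol n (n + 1) =
        (volume (convexHull ℝ (S : Set (EuclideanSpace ℝ (Fin n))))).toReal := by
  classical
  have hinj : Function.Injective (regP n) := by
    intro i j hij
    by_contra h
    have := regP_dist n hn i j h
    rw [hij, dist_self] at this
    exact zero_ne_one this
  have hco : ((Finset.univ.image (regP n) : Finset _) : Set (EuclideanSpace ℝ (Fin n))) =
      range (regP n) := by simp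
  have hle : ∀ i j, dist (regP n i) (regP n j) ≤ 1 := by
    intro i j
    by_cases h : i = j
    · simp [h]
    · exact (regP_dist n hn i j h).le
  have hcard : (Finset.univ.image (regP n)).card = n + 1 := by
    rw [Finset.card_image_of_injective _ hinj]; simp
  have hdiam : Metric.diam (range (regP n)) = 1 := by
    apply le_antisymm
    · apply Metric.diam_le_of_forall_dist_le zero_le_one
      rintro _ ⟨i, rfl⟩ _ ⟨j, rfl⟩
      exact hle i j
    · have h01 : (0 : Fin (n + 1)) ≠ Fin.last n := by
        intro h
        have := congrArg Fin.val h
        simp at this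
        omega
      rw [← regP_dist n hn _ _ h01]
      exact Metric.dist_le_diam_of_mem (finite_range _).isBounded ⟨_, rfl⟩ ⟨_, rfl⟩
  have hvol : (volume (convexHull ℝ (range (regP n)))).toReal =
      (1 / (Nat.factorial n : ℝ)) * Real.sqrt (((n : ℝ) + 1) / 2 ^ n) := by
    rw [vol_hull, edge_regP, regM_abs_det n hn]
  refine ⟨Finset.univ.image (regP n), hcard, ?_, ?_, ?_, ?_⟩
  · intro p hp q hq hpq
    simp only [Finset.mem_image, Finset.mem_univ, true_and] at hp hq
    obtain ⟨i, rfl⟩ := hp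
    obtain ⟨j, rfl⟩ := hq
    exact regP_dist n hn i j (fun h => hpq (by rw [h]))
  · rw [hco, hdiam]
  · rw [hco, hvol]
  · apply IsGreatest.csSup_eq
    refine ⟨⟨_, hcard, by rw [hco, hdiam], rfl⟩, ?_⟩
    rintro v ⟨S, hS, hSd, rfl⟩
    rw [hco, hvol]
    let e := S.equivFinOfCardEq hS
    have hr : (S : Set (EuclideanSpace ℝ (Fin n))) =
        range (fun i => (e.symm i : EuclideanSpace ℝ (Fin n))) := by
      ext y
      constructor
      · intro hy; exact ⟨e ⟨y, hy⟩, by simp⟩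
      · rintro ⟨i, rfl⟩; exact (e.symm i).2
    have hb : ∀ i j, dist (e.symm i : EuclideanSpace ℝ (Fin n)) (e.symm j) ≤ 1 := fun i j =>
      (Metric.dist_le_diam_of_mem S.finite_toSet.isBounded (e.symm i).2 (e.symm j).2).trans hSd
    rw [hr, vol_hull]
    exact mul_le_mul_of_nonneg_left (edge_det_le n hn _ hb) (by positivity)
end
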